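/- There exist constants Θ ≥ 1 and γ₀, γ₁ > 0 such that the following holds. Let κ, T₁, T₂ > 0 with κ²T₁ ≥ Θ and T₂ ≥ T₁, let ρ : [0,1] → [0,∞) be measurable and bounded with ∫₀¹ ρ = 1, let T : [0,1] → (0,∞) be measurable with T₁ ≤ T(y) ≤ T₂ for all y, and let f be a mild steady state of the linear BGK equation with data (κ, T₁, T₂, ρ, T). Then for all x ∈ [0,1], 1 − γ₀ (κ²T₁)^{−1/4} ≤ ρ(x) ≤ 1 + γ₁ (κ²T₁)^{−1/4}. -/

import Mathlib

open MeasureTheory Real Set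

/-- Centered Maxwellian with temperature `T`: `M_T(v) = (2πT)^{-1/2} exp(−v²/(2T))`. -/
noncomputable def Mxw (T v : ℝ) : ℝ :=
  (Real.sqrt (2 * π * T))⁻¹ * Real.exp (-v ^ 2 / (2 * T))

/-- Wall Maxwellian with temperature `T`: `M̃_T(v) = (1/T) exp(−v²/(2T))`,
normalized so that `∫₀^∞ v M̃_T(v) dv = 1`. -/
noncomputable def wallMxw (T v : ℝ) : ℝ :=
  T⁻¹ * Real.exp (-v ^ 2 / (2 * T))

/-- `C_i = ∫₀^∞ v e^{−1/(κv)} M̃_{T_i}(v) dv`. -/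
noncomputable def Cwall (κ T : ℝ) : ℝ :=
  ∫ v in Ioi (0 : ℝ), v * Real.exp (-1 / (κ * v)) * wallMxw T v

/-- `C₋ = (1/κ) ∫₀¹ ρ(y) (∫₀^∞ e^{−y/(κv)} M_{T(y)}(v) dv) dy`. -/
noncomputable def Cminus (κ : ℝ) (ρ T : ℝ → ℝ) : ℝ :=
  κ⁻¹ * ∫ y in Icc (0 : ℝ) 1, ρ y * ∫ v in Ioi (0 : ℝ), Real.exp (-y / (κ * v)) * Mxw (T y) v

/-- `C₊ = (1/κ) ∫₀¹ ρ(y) (∫₀^∞ e^{−(1−y)/(κv)} M_{T(y)}(v) dv) dy`. -/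
noncomputable def Cplus (κ : ℝ) (ρ T : ℝ → ℝ) : ℝ :=
  κ⁻¹ * ∫ y in Icc (0 : ℝ) 1, ρ y * ∫ v in Ioi (0 : ℝ), Real.exp (-(1 - y) / (κ * v)) * Mxw (T y) v

/-- `f` is a mild steady state of the linear BGK equation with data `(κ, T₁, T₂, ρ, T)`. -/
def IsMildSteadyState (κ T₁ T₂ : ℝ) (ρ T : ℝ → ℝ) (f : ℝ → ℝ → ℝ) : Prop :=
  Cwall κ T₁ * Cwall κ T₂ < 1 ∧
  IntegrableOn
    (fun y => ρ y * ∫ v in Ioi (0 : ℝ), Real.exp (-y / (κ * v)) * Mxw (T y) v)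
    (Icc (0 : ℝ) 1) ∧
  IntegrableOn
    (fun y => ρ y * ∫ v in Ioi (0 : ℝ), Real.exp (-(1 - y) / (κ * v)) * Mxw (T y) v)
    (Icc (0 : ℝ) 1) ∧
  (∀ x ∈ Icc (0 : ℝ) 1, ρ x = ∫ v, f x v) ∧
  (∀ x ∈ Icc (0 : ℝ) 1,
    (∀ᵐ v ∂(volume.restrict (Ioi (0 : ℝ))),
      f x v = Real.exp (-x / (κ * v)) * wallMxw T₁ v *
          ((Cminus κ ρ T + Cwall κ T₂ * Cplus κ ρ T) / (1 - Cwall κ T₁ * Cwall κ T₂)) +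
        ∫ y in (0 : ℝ)..x, (κ * v)⁻¹ * Real.exp (-(x - y) / (κ * v)) * ρ y * Mxw (T y) v) ∧
    (∀ᵐ v ∂(volume.restrict (Iio (0 : ℝ))),
      f x v = Real.exp (-(1 - x) / (κ * |v|)) * wallMxw T₂ v *
          ((Cplus κ ρ T + Cwall κ T₁ * Cminus κ ρ T) / (1 - Cwall κ T₁ * Cwall κ T₂)) +
        ∫ y in x..1, (κ * |v|)⁻¹ * Real.exp (-(y - x) / (κ * |v|)) * ρ y * Mxw (T y) v))

lemma Mxw_nonneg (T v : ℝ) : 0 ≤ Mxw T v := by unfold Mxw; positivity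

lemma Mxw_neg (T v : ℝ) : Mxw T (-v) = Mxw T v := by simp [Mxw]

lemma wallMxw_neg (T v : ℝ) : wallMxw T (-v) = wallMxw T v := by simp [wallMxw]

lemma wallMxw_eq {T : ℝ} (hT : 0 < T) (v : ℝ) :
    wallMxw T v = 2 * √(π / (2 * T)) * Mxw T v := by
  have h : T⁻¹ = 2 * √(π / (2 * T)) * (√(2 * π * T))⁻¹ := by
    rw [← Real.sqrt_inv, mul_assoc, ← Real.sqrt_mul (by positivity),
      show π / (2 * T) * (2 * π * T)⁻¹ = (T⁻¹ / 2) ^ 2 by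
        have := Real.pi_pos
        field_simp,
      Real.sqrt_sq (by positivity)]
    ring
  rw [wallMxw, Mxw, h]
  ring

lemma Mxw_le_inv_sqrt {S T : ℝ} (hS : 0 < S) (hST : S ≤ T) (v : ℝ) : Mxw T v ≤ (√S)⁻¹ := by
  have hT : 0 < T := hS.trans_le hST
  have h1 : Real.exp (-v ^ 2 / (2 * T)) ≤ 1 :=
    Real.exp_le_one_iff.2 (div_nonpos_of_nonpos_of_nonneg (by nlinarith [sq_nonneg v]) (by positivity))
  have h2 : (√(2 * π * T))⁻¹ ≤ (√S)⁻¹ := by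
    gcongr
    nlinarith [Real.pi_gt_three]
  calc Mxw T v ≤ (√S)⁻¹ * 1 := by unfold Mxw; gcongr
    _ = _ := mul_one _

lemma Mxw_le_inv {T v : ℝ} (hT : 0 < T) (hv : 0 < v) : Mxw T v ≤ v⁻¹ := by
  have h0 := Real.sq_sqrt hT.le
  have hs : 0 < √T := Real.sqrt_pos.2 hT
  set u := v / √T with hu
  have hvu : v = u * √T := by rw [hu]; field_simp
  have hupos : 0 < u := by positivity
  have h1 : -v ^ 2 / (2 * T) = -(u ^ 2 / 2) := by
    rw [hvu, mul_pow, h0]; field_simp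
  have h2 : u ≤ Real.exp (u ^ 2 / 2) := by
    have := Real.add_one_le_exp (u ^ 2 / 2)
    nlinarith [sq_nonneg (u - 1)]
  have h3 : (√(2 * π * T))⁻¹ ≤ (√T)⁻¹ := by
    gcongr
    nlinarith [Real.pi_gt_three]
  calc Mxw T v ≤ (√T)⁻¹ * (Real.exp (u ^ 2 / 2))⁻¹ := by
        rw [Mxw, h1, Real.exp_neg]; gcongr
    _ ≤ (√T)⁻¹ * u⁻¹ := by gcongr
    _ = v⁻¹ := by rw [hvu, mul_inv, mul_comm]

lemma integrable_Mxw {T : ℝ} (hT : 0 < T) : Integrable (Mxw T) := by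
  have := (integrable_exp_neg_mul_sq (b := 1 / (2 * T)) (by positivity)).const_mul
    (√(2 * π * T))⁻¹
  refine this.congr (Filter.Eventually.of_forall fun v => ?_)
  simp only [Mxw]
  congr 2
  ring

lemma integral_Ioi_Mxw {T : ℝ} (hT : 0 < T) : ∫ v in Ioi (0 : ℝ), Mxw T v = 1 / 2 := by
  have h := integral_gaussian_Ioi (1 / (2 * T))
  have e : ∀ v : ℝ, Mxw T v = (√(2 * π * T))⁻¹ * Real.exp (-(1 / (2 * T)) * v ^ 2) := by
    intro v
    simp only [Mxw]
    congr 2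
    ring
  simp_rw [e]
  rw [integral_const_mul, h, show π / (1 / (2 * T)) = 2 * π * T by field_simp]
  have : √(2 * π * T) ≠ 0 := (Real.sqrt_pos.2 (by positivity)).ne'
  field_simp

lemma integrableOn_mul_wallMxw {T : ℝ} (hT : 0 < T) :
    IntegrableOn (fun v => v * wallMxw T v) (Ioi 0) := by
  have := (integrable_mul_exp_neg_mul_sq (b := 1 / (2 * T)) (by positivity)).const_mul T⁻¹
  refine (this.congr (Filter.Eventually.of_forall fun v => ?_)).integrableOn
  simp only [wallMxw]
  rw [show -v ^ 2 / (2 * T) = -(1 / (2 * T)) * v ^ 2 by ring]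
  ring

lemma integral_mul_wallMxw {T : ℝ} (hT : 0 < T) :
    ∫ v in Ioi (0 : ℝ), v * wallMxw T v = 1 := by
  have hd : ∀ v ∈ Ici (0 : ℝ),
      HasDerivAt (fun v => -Real.exp (-v ^ 2 / (2 * T))) (v * wallMxw T v) v := by
    intro v _
    have h1 : HasDerivAt (fun v : ℝ => -v ^ 2 / (2 * T)) (-(2 * v) / (2 * T)) v := by
      simpa using ((hasDerivAt_pow 2 v).neg).div_const (2 * T)
    have h2 : v * wallMxw T v = -(Real.exp (-v ^ 2 / (2 * T)) * (-(2 * v) / (2 * T))) := by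
      rw [wallMxw]
      field_simp
    rw [h2]
    exact h1.exp.neg
  have hlim : Filter.Tendsto (fun v => -Real.exp (-v ^ 2 / (2 * T))) Filter.atTop (nhds (-0)) := by
    refine (Real.tendsto_exp_atBot.comp ?_).neg
    have h2 : Filter.Tendsto (fun v : ℝ => v ^ 2 / (2 * T)) Filter.atTop Filter.atTop :=
      (Filter.tendsto_pow_atTop two_ne_zero).atTop_div_const (by positivity)
    refine (Filter.tendsto_neg_atTop_atBot.comp h2).congr fun v => ?_
    simp only [Function.comp]
    ring
  rw [integral_Ioi_of_hasDerivAt_of_tendsto' hd (integrableOn_mul_wallMxw hT) hlim]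
  simp

/-- A majorant of `(κv)^{-1/2} M_T(v)`, uniform in `T ≥ S`. -/
noncomputable def slowMajorant (κ S v : ℝ) : ℝ :=
  if v ≤ √S then κ ^ (-1 / 2 : ℝ) * (√S)⁻¹ * v ^ (-1 / 2 : ℝ) else κ ^ (-1 / 2 : ℝ) * v ^ (-3 / 2 : ℝ)

lemma inv_sqrt_mul_Mxw_le {κ S T v : ℝ} (hκ : 0 < κ) (hS : 0 < S) (hST : S ≤ T) (hv : 0 < v) :
    (√(κ * v))⁻¹ * Mxw T v ≤ slowMajorant κ S v := by
  have e : (√(κ * v))⁻¹ = κ ^ (-1 / 2 : ℝ) * v ^ (-1 / 2 : ℝ) := by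
    rw [Real.sqrt_eq_rpow, ← Real.rpow_neg (by positivity), Real.mul_rpow hκ.le hv.le]
    norm_num
  rw [slowMajorant, e]
  split_ifs
  · rw [mul_right_comm]
    gcongr
    exact Mxw_le_inv_sqrt hS hST v
  · rw [mul_assoc, show (-3 / 2 : ℝ) = -1 / 2 + -1 by norm_num, Real.rpow_add hv,
      Real.rpow_neg_one]
    gcongr
    exact Mxw_le_inv (hS.trans_le hST) hv

lemma integrableOn_slowMajorant (κ : ℝ) {S : ℝ} (hS : 0 < S) :
    IntegrableOn (slowMajorant κ S) (Ioc 0 (√S)) ∧ IntegrableOn (slowMajorant κ S) (Ioi (√S)) := by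
  have hs : 0 < √S := Real.sqrt_pos.2 hS
  constructor
  · have h : IntegrableOn (fun v : ℝ => v ^ (-1 / 2 : ℝ)) (Ioc 0 (√S)) :=
      (intervalIntegrable_iff_integrableOn_Ioc_of_le hs.le).1
        (intervalIntegral.intervalIntegrable_rpow' (by norm_num))
    refine IntegrableOn.congr_fun (h.const_mul (κ ^ (-1 / 2 : ℝ) * (√S)⁻¹)) (fun v hv => ?_)
      measurableSet_Ioc
    simp [slowMajorant, hv.2]
  · have h : IntegrableOn (fun v : ℝ => v ^ (-3 / 2 : ℝ)) (Ioi (√S)) :=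
      integrableOn_Ioi_rpow_of_lt (by norm_num) hs
    refine IntegrableOn.congr_fun (h.const_mul (κ ^ (-1 / 2 : ℝ))) (fun v hv => ?_)
      measurableSet_Ioi
    simp [slowMajorant, not_le.2 (mem_Ioi.1 hv)]

lemma integrableOn_Ioi_slowMajorant (κ : ℝ) {S : ℝ} (hS : 0 < S) :
    IntegrableOn (slowMajorant κ S) (Ioi 0) := by
  rw [← Ioc_union_Ioi_eq_Ioi (Real.sqrt_nonneg S)]
  exact (integrableOn_slowMajorant κ hS).1.union (integrableOn_slowMajorant κ hS).2

lemma integral_slowMajorant {κ S : ℝ} (hκ : 0 < κ) (hS : 0 < S) :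
    ∫ v in Ioi (0 : ℝ), slowMajorant κ S v = 4 * (κ ^ 2 * S) ^ (-(1 : ℝ) / 4) := by
  have hs : 0 < √S := Real.sqrt_pos.2 hS
  rw [← Ioc_union_Ioi_eq_Ioi (Real.sqrt_nonneg S),
    setIntegral_union (Ioc_disjoint_Ioi le_rfl) measurableSet_Ioi
      (integrableOn_slowMajorant κ hS).1 (integrableOn_slowMajorant κ hS).2]
  have h1 : ∫ v in Ioc 0 (√S), slowMajorant κ S v =
      ∫ v in Ioc 0 (√S), κ ^ (-1 / 2 : ℝ) * (√S)⁻¹ * v ^ (-1 / 2 : ℝ) :=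
    setIntegral_congr_fun measurableSet_Ioc fun v hv => by simp [slowMajorant, hv.2]
  have h2 : ∫ v in Ioi (√S), slowMajorant κ S v =
      ∫ v in Ioi (√S), κ ^ (-1 / 2 : ℝ) * v ^ (-3 / 2 : ℝ) :=
    setIntegral_congr_fun measurableSet_Ioi fun v hv => by
      simp [slowMajorant, not_le.2 (mem_Ioi.1 hv)]
  rw [h1, h2, integral_const_mul, integral_const_mul, integral_Ioi_rpow_of_lt (by norm_num) hs,
    ← intervalIntegral.integral_of_le hs.le, integral_rpow (Or.inl (by norm_num)),
    Real.mul_rpow (by positivity) hS.le, ← Real.rpow_natCast, ← Real.rpow_mul hκ.le]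
  have e1 : (√S)⁻¹ = S ^ (-1 / 2 : ℝ) := by
    rw [Real.sqrt_eq_rpow, ← Real.rpow_neg hS.le]; norm_num
  have e2 : ∀ r : ℝ, (√S) ^ r = S ^ (r / 2) := fun r => by
    rw [Real.sqrt_eq_rpow, ← Real.rpow_mul hS.le]; ring_nf
  have e3 : S ^ (-(1 / 4) : ℝ) = S ^ (-(1 / 2) : ℝ) * S ^ (1 / 4 : ℝ) := by
    rw [← Real.rpow_add hS]; norm_num
  rw [e1, e2, e2, Real.zero_rpow (by norm_num)]
  norm_num
  rw [e3]
  ring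

lemma one_sub_exp_neg_le_sqrt {s : ℝ} (hs : 0 ≤ s) : 1 - Real.exp (-s) ≤ √s := by
  rcases le_total s 1 with h | h
  · have h1 := Real.add_one_le_exp (-s)
    have h2 : s ≤ √s := Real.le_sqrt_of_sq_le (by nlinarith)
    linarith
  · have h1 := Real.exp_pos (-s)
    have h2 : 1 ≤ √s := Real.one_le_sqrt.2 h
    linarith

lemma exp_neg_le_one_sub_add {s : ℝ} (hs : 0 ≤ s) : Real.exp (-s) ≤ 1 - s + s * √s := by
  rcases le_total s 1 with h | h
  · have h1 := Real.add_one_le_exp s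
    have h2 : s ≤ √s := Real.le_sqrt_of_sq_le (by nlinarith)
    have h3 : Real.exp (-s) ≤ 1 - s + s * s := by
      rw [Real.exp_neg, inv_le_iff_one_le_mul₀ (Real.exp_pos s)]
      have h4 : 0 ≤ 1 - s + s * s := by nlinarith
      have h5 : 0 ≤ s * s * s := by positivity
      nlinarith
    nlinarith
  · have h1 : Real.exp (-s) ≤ 1 := Real.exp_le_one_iff.2 (by linarith)
    have h2 : 1 ≤ √s := Real.one_le_sqrt.2 h
    nlinarith

lemma inv_mul_exp_le {t r : ℝ} (ht : 0 < t) (hr : 0 < r) :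
    t⁻¹ * Real.exp (-r / t) ≤ (√t)⁻¹ * (√r)⁻¹ := by
  have h1 : √(r / t) ≤ Real.exp (r / t) := by
    have h2 := Real.add_one_le_exp (r / t)
    have h3 := Real.sq_sqrt (div_pos hr ht).le
    nlinarith [sq_nonneg (√(r / t) - 1), Real.sqrt_nonneg (r / t)]
  have hst : 0 < √t := Real.sqrt_pos.2 ht
  have hsr : 0 < √r := Real.sqrt_pos.2 hr
  have h4 : Real.exp (-r / t) ≤ (√(r / t))⁻¹ := by
    rw [neg_div, Real.exp_neg]
    exact inv_anti₀ (Real.sqrt_pos.2 (div_pos hr ht)) h1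
  calc t⁻¹ * Real.exp (-r / t) ≤ t⁻¹ * (√(r / t))⁻¹ := by gcongr
    _ = (√t)⁻¹ * (√r)⁻¹ := by
      rw [Real.sqrt_div hr.le]
      nth_rewrite 1 [← Real.mul_self_sqrt ht.le]
      field_simp

lemma exp_neg_div_le_one {κ r v : ℝ} (hκ : 0 < κ) (hr : 0 ≤ r) (hv : 0 < v) :
    Real.exp (-r / (κ * v)) ≤ 1 :=
  Real.exp_le_one_iff.2 (div_nonpos_of_nonpos_of_nonneg (by linarith) (by positivity))

lemma integrableOn_exp_mul {κ r : ℝ} (hκ : 0 < κ) (hr : 0 ≤ r) {g : ℝ → ℝ}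
    (hg : IntegrableOn g (Ioi 0)) :
    IntegrableOn (fun v => Real.exp (-r / (κ * v)) * g v) (Ioi 0) := by
  refine Integrable.bdd_mul (c := 1) hg (by fun_prop : Measurable _).aestronglyMeasurable ?_
  refine (ae_restrict_iff' measurableSet_Ioi).2 (Filter.Eventually.of_forall fun v hv => ?_)
  rw [Real.norm_eq_abs, Real.abs_exp]
  exact exp_neg_div_le_one hκ hr hv

lemma integral_exp_mul_Mxw_le {κ r T : ℝ} (hκ : 0 < κ) (hr : 0 ≤ r) (hT : 0 < T) :
    ∫ v in Ioi (0 : ℝ), Real.exp (-r / (κ * v)) * Mxw T v ≤ 1 / 2 := by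
  rw [← integral_Ioi_Mxw hT]
  refine setIntegral_mono_on (integrableOn_exp_mul hκ hr (integrable_Mxw hT).integrableOn)
    (integrable_Mxw hT).integrableOn measurableSet_Ioi fun v hv => ?_
  exact mul_le_of_le_one_left (Mxw_nonneg T v) (exp_neg_div_le_one hκ hr hv)

lemma le_integral_exp_mul_Mxw {κ r S T : ℝ} (hκ : 0 < κ) (hr : 0 ≤ r) (hr1 : r ≤ 1) (hS : 0 < S)
    (hST : S ≤ T) :
    1 / 2 - 4 * (κ ^ 2 * S) ^ (-(1 : ℝ) / 4) ≤
      ∫ v in Ioi (0 : ℝ), Real.exp (-r / (κ * v)) * Mxw T v := by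
  have hT : 0 < T := hS.trans_le hST
  rw [← integral_Ioi_Mxw hT, ← integral_slowMajorant hκ hS,
    ← integral_sub (integrable_Mxw hT).integrableOn (integrableOn_Ioi_slowMajorant κ hS)]
  refine setIntegral_mono_on
    ((integrable_Mxw hT).integrableOn.sub (integrableOn_Ioi_slowMajorant κ hS))
    (integrableOn_exp_mul hκ hr (integrable_Mxw hT).integrableOn) measurableSet_Ioi fun v hv => ?_
  have hv0 : 0 < v := hv
  have h1 := one_sub_exp_neg_le_sqrt (s := r / (κ * v)) (by positivity)
  have h2 : √(r / (κ * v)) ≤ (√(κ * v))⁻¹ := by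
    rw [← Real.sqrt_inv]
    apply Real.sqrt_le_sqrt
    rw [div_eq_mul_inv]
    exact mul_le_of_le_one_left (by positivity) hr1
  have h3 := inv_sqrt_mul_Mxw_le hκ hS hST hv0
  rw [neg_div]
  nlinarith [mul_le_mul_of_nonneg_right (h1.trans h2) (Mxw_nonneg T v)]

lemma integral_exp_mul_wallMxw {κ r T : ℝ} (hT : 0 < T) :
    ∫ v in Ioi (0 : ℝ), Real.exp (-r / (κ * v)) * wallMxw T v =
      2 * √(π / (2 * T)) * ∫ v in Ioi (0 : ℝ), Real.exp (-r / (κ * v)) * Mxw T v := by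
  rw [← integral_const_mul]
  congr 1
  ext v
  rw [wallMxw_eq hT]
  ring

lemma integrableOn_wallMxw {T : ℝ} (hT : 0 < T) : IntegrableOn (wallMxw T) (Ioi 0) := by
  rw [show wallMxw T = fun v => 2 * √(π / (2 * T)) * Mxw T v from funext (wallMxw_eq hT)]
  exact (integrable_Mxw hT).integrableOn.const_mul _

lemma integral_wallMxw {T : ℝ} (hT : 0 < T) :
    ∫ v in Ioi (0 : ℝ), wallMxw T v = √(π / (2 * T)) := by
  simp_rw [wallMxw_eq hT]
  rw [integral_const_mul, integral_Ioi_Mxw hT]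
  ring

lemma wallMxw_nonneg {T : ℝ} (hT : 0 < T) (v : ℝ) : 0 ≤ wallMxw T v := by
  unfold wallMxw; positivity

lemma integrableOn_Cwall {κ T : ℝ} (hκ : 0 < κ) (hT : 0 < T) :
    IntegrableOn (fun v => v * Real.exp (-1 / (κ * v)) * wallMxw T v) (Ioi 0) := by
  refine (integrableOn_exp_mul hκ zero_le_one (integrableOn_mul_wallMxw hT)).congr
    (Filter.Eventually.of_forall fun v => ?_)
  simp only
  ring

lemma le_Cwall {κ T : ℝ} (hκ : 0 < κ) (hT : 0 < T) : 1 - κ⁻¹ * √(π / (2 * T)) ≤ Cwall κ T := by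
  have hi := (integrableOn_wallMxw hT).const_mul κ⁻¹
  rw [← integral_mul_wallMxw hT, ← integral_wallMxw hT, ← integral_const_mul,
    ← integral_sub (integrableOn_mul_wallMxw hT) hi]
  refine setIntegral_mono_on ((integrableOn_mul_wallMxw hT).sub hi) (integrableOn_Cwall hκ hT)
    measurableSet_Ioi fun v hv => ?_
  have hv0 : 0 < v := hv
  have h1 := Real.add_one_le_exp (-1 / (κ * v))
  have h2 : v * (-1 / (κ * v) + 1) = v - κ⁻¹ := by field_simp; ring
  have h3 := mul_le_mul_of_nonneg_right (mul_le_mul_of_nonneg_left h1 hv0.le) (wallMxw_nonneg hT v)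
  rw [h2] at h3
  linarith

lemma Cwall_le {κ S T : ℝ} (hκ : 0 < κ) (hS : 0 < S) (hST : S ≤ T) :
    Cwall κ T ≤ 1 - κ⁻¹ * √(π / (2 * T)) * (1 - 8 * (κ ^ 2 * S) ^ (-(1 : ℝ) / 4)) := by
  have hT : 0 < T := hS.trans_le hST
  have hi := (integrableOn_wallMxw hT).const_mul κ⁻¹
  have hj := (integrableOn_Ioi_slowMajorant κ hS).const_mul (κ⁻¹ * (2 * √(π / (2 * T))))
  have hs : IntegrableOn (fun v => v * wallMxw T v - κ⁻¹ * wallMxw T v) (Ioi 0) :=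
    (integrableOn_mul_wallMxw hT).sub hi
  have e : 1 - κ⁻¹ * √(π / (2 * T)) * (1 - 8 * (κ ^ 2 * S) ^ (-(1 : ℝ) / 4)) =
      1 - κ⁻¹ * √(π / (2 * T)) +
        κ⁻¹ * (2 * √(π / (2 * T))) * (4 * (κ ^ 2 * S) ^ (-(1 : ℝ) / 4)) := by ring
  rw [e, ← integral_slowMajorant hκ hS, ← integral_const_mul]
  conv_rhs => rw [← integral_mul_wallMxw hT, ← integral_wallMxw hT, ← integral_const_mul κ⁻¹,
    ← integral_sub (integrableOn_mul_wallMxw hT) hi, integral_wallMxw hT,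
    ← integral_add hs hj]
  refine setIntegral_mono_on (integrableOn_Cwall hκ hT)
    (hs.add hj) measurableSet_Ioi fun v hv => ?_
  have hv0 : 0 < v := hv
  have h1 := exp_neg_le_one_sub_add (s := (κ * v)⁻¹) (by positivity)
  rw [Real.sqrt_inv] at h1
  have h2 : v * (1 - (κ * v)⁻¹ + (κ * v)⁻¹ * (√(κ * v))⁻¹) = v - κ⁻¹ + κ⁻¹ * (√(κ * v))⁻¹ := by
    have : √(κ * v) ≠ 0 := (Real.sqrt_pos.2 (by positivity)).ne'
    field_simp
  have h3 := mul_le_mul_of_nonneg_right (mul_le_mul_of_nonneg_left h1 hv0.le) (wallMxw_nonneg hT v)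
  rw [h2] at h3
  have h4 := mul_le_mul_of_nonneg_left (inv_sqrt_mul_Mxw_le hκ hS hST hv0)
    (show 0 ≤ κ⁻¹ * (2 * √(π / (2 * T))) by positivity)
  have h5 : κ⁻¹ * (√(κ * v))⁻¹ * wallMxw T v =
      κ⁻¹ * (2 * √(π / (2 * T))) * ((√(κ * v))⁻¹ * Mxw T v) := by
    rw [wallMxw_eq hT]; ring
  rw [show -1 / (κ * v) = -(κ * v)⁻¹ by rw [neg_div, one_div]]
  linarith

lemma integrableOn_inv_sqrt_sub_left {x : ℝ} (hx : 0 ≤ x) :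
    IntegrableOn (fun y => (√(x - y))⁻¹) (Ioo 0 x) ∧
      ∫ y in Ioo 0 x, (√(x - y))⁻¹ = 2 * √x := by
  have e : ∀ y ∈ Ioo 0 x, (√(x - y))⁻¹ = (x - y) ^ (-1 / 2 : ℝ) := fun y hy => by
    rw [Real.sqrt_eq_rpow, ← Real.rpow_neg (sub_nonneg.2 hy.2.le)]
    norm_num
  have hi : IntervalIntegrable (fun y : ℝ => y ^ (-1 / 2 : ℝ)) volume 0 x :=
    intervalIntegral.intervalIntegrable_rpow' (by norm_num)
  constructor
  · have h := (hi.comp_sub_left x).symm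
    simp only [sub_zero, sub_self] at h
    exact IntegrableOn.congr_fun ((intervalIntegrable_iff_integrableOn_Ioo_of_le hx).1 h)
      (fun y hy => (e y hy).symm) measurableSet_Ioo
  · rw [setIntegral_congr_fun measurableSet_Ioo e, ← integral_Ioc_eq_integral_Ioo,
      ← intervalIntegral.integral_of_le hx,
      intervalIntegral.integral_comp_sub_left (fun y => y ^ (-1 / 2 : ℝ)), sub_self, sub_zero,
      integral_rpow (Or.inl (by norm_num)), Real.zero_rpow (by norm_num), Real.sqrt_eq_rpow]
    norm_num
    ring

lemma integrableOn_inv_sqrt_sub_right {x : ℝ} (hx : x ≤ 1) :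
    IntegrableOn (fun y => (√(y - x))⁻¹) (Ioo x 1) ∧
      ∫ y in Ioo x 1, (√(y - x))⁻¹ = 2 * √(1 - x) := by
  have e : ∀ y ∈ Ioo x 1, (√(y - x))⁻¹ = (y - x) ^ (-1 / 2 : ℝ) := fun y hy => by
    rw [Real.sqrt_eq_rpow, ← Real.rpow_neg (sub_nonneg.2 hy.1.le)]
    norm_num
  have hi : IntervalIntegrable (fun y : ℝ => y ^ (-1 / 2 : ℝ)) volume 0 (1 - x) :=
    intervalIntegral.intervalIntegrable_rpow' (by norm_num)
  constructor
  · have h := hi.comp_sub_right x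
    simp only [zero_add, sub_add_cancel] at h
    exact IntegrableOn.congr_fun ((intervalIntegrable_iff_integrableOn_Ioo_of_le hx).1 h)
      (fun y hy => (e y hy).symm) measurableSet_Ioo
  · rw [setIntegral_congr_fun measurableSet_Ioo e, ← integral_Ioc_eq_integral_Ioo,
      ← intervalIntegral.integral_of_le hx,
      intervalIntegral.integral_comp_sub_right (fun y => y ^ (-1 / 2 : ℝ)), sub_self,
      integral_rpow (Or.inl (by norm_num)), Real.zero_rpow (by norm_num), Real.sqrt_eq_rpow]
    norm_num
    ring

/-- Density carried by the particles moving in one direction: a wall contribution plus a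
nonnegative volume contribution controlled by a bound on the density. -/
lemma half_density_bounds {κ S W F B a b d : ℝ} {ρ T r g : ℝ → ℝ} (hκ : 0 < κ) (hS : 0 < S)
    (hW : 0 < W) (hB : 0 ≤ B) (hd : 0 ≤ d) (hρm : Measurable ρ) (hρ : ∀ y, 0 ≤ ρ y)
    (hTm : Measurable T) (hrm : Measurable r) (hρB : ∀ y ∈ Ioo a b, ρ y ≤ B)
    (hTS : ∀ y ∈ Ioo a b, S ≤ T y) (hr : ∀ y ∈ Ioo a b, 0 < r y)
    (hri : IntegrableOn (fun y => (√(r y))⁻¹) (Ioo a b))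
    (hr2 : ∫ y in Ioo a b, (√(r y))⁻¹ ≤ 2)
    (hg : ∀ᵐ v ∂(volume.restrict (Ioi (0 : ℝ))),
      g v = Real.exp (-d / (κ * v)) * wallMxw W v * F +
        ∫ y in Ioo a b, (κ * v)⁻¹ * Real.exp (-r y / (κ * v)) * ρ y * Mxw (T y) v) :
    IntegrableOn g (Ioi 0) ∧
      (∫ v in Ioi (0 : ℝ), Real.exp (-d / (κ * v)) * wallMxw W v) * F ≤
        ∫ v in Ioi (0 : ℝ), g v ∧
      ∫ v in Ioi (0 : ℝ), g v ≤
        (∫ v in Ioi (0 : ℝ), Real.exp (-d / (κ * v)) * wallMxw W v) * F +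
          8 * (κ ^ 2 * S) ^ (-(1 : ℝ) / 4) * B := by
  set h : ℝ → ℝ := fun v =>
    ∫ y in Ioo a b, (κ * v)⁻¹ * Real.exp (-r y / (κ * v)) * ρ y * Mxw (T y) v with hh
  have hnn : ∀ v, 0 < v → ∀ y,
      0 ≤ (κ * v)⁻¹ * Real.exp (-r y / (κ * v)) * ρ y * Mxw (T y) v := fun v hv y => by
    have := hρ y
    have := Mxw_nonneg (T y) v
    positivity
  have h0 : ∀ v, 0 < v → 0 ≤ h v := fun v hv => integral_nonneg (hnn v hv)
  have hle : ∀ v, 0 < v → h v ≤ 2 * B * slowMajorant κ S v := by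
    intro v hv
    have hm : 0 ≤ slowMajorant κ S v :=
      (mul_nonneg (by positivity) (Mxw_nonneg S v)).trans (inv_sqrt_mul_Mxw_le hκ hS le_rfl hv)
    calc h v ≤ ∫ y in Ioo a b, B * slowMajorant κ S v * (√(r y))⁻¹ := by
          refine integral_mono_of_nonneg (Filter.Eventually.of_forall (hnn v hv))
            (hri.const_mul _)
            ((ae_restrict_iff' measurableSet_Ioo).2 (Filter.Eventually.of_forall fun y hy => ?_))
          have h1 := inv_mul_exp_le (mul_pos hκ hv) (hr y hy)
          have h2 := inv_sqrt_mul_Mxw_le hκ hS (hTS y hy) hv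
          have h3 := hρ y
          have h4 := Mxw_nonneg (T y) v
          calc (κ * v)⁻¹ * Real.exp (-r y / (κ * v)) * ρ y * Mxw (T y) v
              ≤ (√(κ * v))⁻¹ * (√(r y))⁻¹ * ρ y * Mxw (T y) v := by gcongr
            _ = ρ y * ((√(κ * v))⁻¹ * Mxw (T y) v) * (√(r y))⁻¹ := by ring
            _ ≤ B * slowMajorant κ S v * (√(r y))⁻¹ := by
                gcongr
                exact hρB y hy
      _ = B * slowMajorant κ S v * ∫ y in Ioo a b, (√(r y))⁻¹ := integral_const_mul _ _
      _ ≤ B * slowMajorant κ S v * 2 := by gcongr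
      _ = _ := by ring
  have hmeas : StronglyMeasurable h := by
    have : Measurable (fun p : ℝ × ℝ =>
        (κ * p.1)⁻¹ * Real.exp (-r p.2 / (κ * p.1)) * ρ p.2 * Mxw (T p.2) p.1) := by
      unfold Mxw
      fun_prop
    exact this.stronglyMeasurable.integral_prod_right'
  have hmaj := (integrableOn_Ioi_slowMajorant κ hS).const_mul (2 * B)
  have hint : IntegrableOn h (Ioi 0) := by
    refine Integrable.mono' hmaj hmeas.aestronglyMeasurable
      ((ae_restrict_iff' measurableSet_Ioi).2 (Filter.Eventually.of_forall fun v hv => ?_))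
    rw [Real.norm_eq_abs, abs_of_nonneg (h0 v hv)]
    exact hle v hv
  have hwall := (integrableOn_exp_mul hκ hd (integrableOn_wallMxw hW)).mul_const F
  have hgi : ∫ v in Ioi (0 : ℝ), g v =
      (∫ v in Ioi (0 : ℝ), Real.exp (-d / (κ * v)) * wallMxw W v) * F +
        ∫ v in Ioi (0 : ℝ), h v := by
    rw [integral_congr_ae hg, integral_add hwall hint, integral_mul_const]
  have hhi : ∫ v in Ioi (0 : ℝ), h v ≤ 8 * (κ ^ 2 * S) ^ (-(1 : ℝ) / 4) * B := by
    calc ∫ v in Ioi (0 : ℝ), h v ≤ ∫ v in Ioi (0 : ℝ), 2 * B * slowMajorant κ S v :=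
          setIntegral_mono_on hint hmaj measurableSet_Ioi hle
      _ = _ := by rw [integral_const_mul, integral_slowMajorant hκ hS]; ring
  refine ⟨(hwall.add hint).congr (hg.mono fun v hv => hv.symm), ?_, ?_⟩
  · rw [hgi]
    exact le_add_of_nonneg_right (setIntegral_nonneg measurableSet_Ioi h0)
  · rw [hgi]
    gcongr

lemma weighted_average_bounds {ρ φ : ℝ → ℝ} {L U : ℝ} (hρ : ∀ y, 0 ≤ ρ y)
    (hρ1 : ∫ y in Icc (0 : ℝ) 1, ρ y = 1) (hi : IntegrableOn (fun y => ρ y * φ y) (Icc 0 1))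
    (hL : ∀ y ∈ Icc (0 : ℝ) 1, L ≤ φ y) (hU : ∀ y ∈ Icc (0 : ℝ) 1, φ y ≤ U) :
    L ≤ ∫ y in Icc (0 : ℝ) 1, ρ y * φ y ∧ ∫ y in Icc (0 : ℝ) 1, ρ y * φ y ≤ U := by
  have hρi : IntegrableOn ρ (Icc 0 1) := by
    by_contra hn
    rw [integral_undef hn] at hρ1
    exact zero_ne_one hρ1
  have e : ∀ c : ℝ, ∫ y in Icc (0 : ℝ) 1, ρ y * c = c := fun c => by
    rw [integral_mul_const, hρ1, one_mul]
  constructor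
  · rw [← e L]
    exact setIntegral_mono_on (hρi.mul_const L) (by simpa only [e] using hi) measurableSet_Icc
      fun y hy => by simpa only [e] using mul_le_mul_of_nonneg_left (hL y hy) (hρ y)
  · conv_rhs => rw [← e U]
    exact setIntegral_mono_on hi (hρi.mul_const U) measurableSet_Icc
      fun y hy => mul_le_mul_of_nonneg_left (hU y hy) (hρ y)

lemma inv_mul_sqrt_le {κ S T : ℝ} (hκ : 0 < κ) (hS : 0 < S) (hST : S ≤ T) :
    κ⁻¹ * √(π / (2 * T)) ≤ 2 * ((κ ^ 2 * S) ^ (-(1 : ℝ) / 4)) ^ 2 := by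
  have hT : 0 < T := hS.trans_le hST
  have h1 : √(π / (2 * T)) ≤ 2 * (√S)⁻¹ := by
    rw [Real.sqrt_le_left (by positivity), mul_pow, inv_pow, Real.sq_sqrt hS.le,
      ← div_eq_mul_inv, div_le_div_iff₀ (by positivity) hS]
    nlinarith [Real.pi_le_four, Real.pi_pos]
  have h2 : ((κ ^ 2 * S) ^ (-(1 : ℝ) / 4)) ^ 2 = κ⁻¹ * (√S)⁻¹ := by
    rw [← Real.rpow_natCast, ← Real.rpow_mul (by positivity), ← mul_inv,
      show κ * √S = √(κ ^ 2 * S) by rw [Real.sqrt_mul (by positivity), Real.sqrt_sq hκ.le],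
      Real.sqrt_eq_rpow, ← Real.rpow_neg (by positivity)]
    norm_num
  calc κ⁻¹ * √(π / (2 * T)) ≤ κ⁻¹ * (2 * (√S)⁻¹) := by gcongr
    _ = _ := by rw [h2]; ring

lemma wall_contribution_bounds {η k a₁ a₂ c₁ c₂ m p A₁ A₂ : ℝ} (hη : 0 < η) (hη1 : η ≤ 1 / 32)
    (hk : 0 < k) (ha₁ : 0 < a₁) (ha₂ : 0 < a₂) (hka₁ : k * a₁ ≤ 2 * η) (hka₂ : k * a₂ ≤ 2 * η)
    (hc₁ : 1 - k * a₁ ≤ c₁) (hc₂ : 1 - k * a₂ ≤ c₂)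
    (hc₁' : c₁ ≤ 1 - k * a₁ * (1 - 8 * η)) (hc₂' : c₂ ≤ 1 - k * a₂ * (1 - 8 * η))
    (hm : k * (1 / 2 - 4 * η) ≤ m) (hm' : m ≤ k * (1 / 2))
    (hp : k * (1 / 2 - 4 * η) ≤ p) (hp' : p ≤ k * (1 / 2))
    (hA₁ : a₁ * (1 - 8 * η) ≤ A₁) (hA₁' : A₁ ≤ a₁)
    (hA₂ : a₂ * (1 - 8 * η) ≤ A₂) (hA₂' : A₂ ≤ a₂) :
    1 - 17 * η ≤ A₁ * ((m + c₂ * p) / (1 - c₁ * c₂)) + A₂ * ((p + c₁ * m) / (1 - c₁ * c₂)) ∧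
      A₁ * ((m + c₂ * p) / (1 - c₁ * c₂)) + A₂ * ((p + c₁ * m) / (1 - c₁ * c₂)) ≤ 1 + 20 * η := by
  have hka₁0 : 0 < k * a₁ := mul_pos hk ha₁
  have hka₂0 : 0 < k * a₂ := mul_pos hk ha₂
  have h8 : 0 < 1 - 8 * η := by linarith
  have hc₁1 : c₁ ≤ 1 := by nlinarith
  have hc₂1 : c₂ ≤ 1 := by nlinarith
  have hc₁0 : 1 - 2 * η ≤ c₁ := by linarith
  have hc₂0 : 1 - 2 * η ≤ c₂ := by linarith
  have hm0 : 0 < m := lt_of_lt_of_le (mul_pos hk (by linarith)) hm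
  have hp0 : 0 < p := lt_of_lt_of_le (mul_pos hk (by linarith)) hp
  have hD : 1 - c₁ * c₂ ≤ k * a₁ + k * a₂ := by nlinarith
  have hD' : (k * a₁ + k * a₂) * (1 - 10 * η) ≤ 1 - c₁ * c₂ := by
    have h1 : k * a₂ * (1 - 8 * η) * (1 - 2 * η) ≤ (1 - c₂) * c₁ :=
      mul_le_mul (by linarith) hc₁0 (by linarith) (by linarith)
    nlinarith [mul_pos hka₁0 hη, mul_pos (mul_pos hka₂0 hη) hη]
  have hD0 : 0 < 1 - c₁ * c₂ := lt_of_lt_of_le (mul_pos (by linarith) (by linarith)) hD'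
  have lower : ∀ {m p c : ℝ}, k * (1 / 2 - 4 * η) ≤ m → k * (1 / 2 - 4 * η) ≤ p →
      1 - 2 * η ≤ c → k * (1 - 9 * η) ≤ m + c * p := by
    intro m p c hm hp hc
    have h1 : (1 - 2 * η) * (k * (1 / 2 - 4 * η)) ≤ c * p :=
      mul_le_mul hc hp (mul_nonneg hk.le (by linarith)) (by linarith)
    nlinarith [mul_pos (mul_pos hk hη) hη]
  have upper : ∀ {m p c : ℝ}, m ≤ k * (1 / 2) → 0 < p → p ≤ k * (1 / 2) → c ≤ 1 →
      m + c * p ≤ k := by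
    intro m p c hm hp0 hp hc
    nlinarith
  rw [← mul_div_assoc, ← mul_div_assoc, ← add_div, le_div_iff₀ hD0, div_le_iff₀ hD0]
  constructor
  · have h1 : a₁ * (1 - 8 * η) * (k * (1 - 9 * η)) ≤ A₁ * (m + c₂ * p) :=
      mul_le_mul hA₁ (lower hm hp hc₂0) (mul_nonneg hk.le (by linarith)) (by nlinarith)
    have h2 : a₂ * (1 - 8 * η) * (k * (1 - 9 * η)) ≤ A₂ * (p + c₁ * m) :=
      mul_le_mul hA₂ (lower hp hm hc₁0) (mul_nonneg hk.le (by linarith)) (by nlinarith)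
    have h3 : (1 - 17 * η) * (1 - c₁ * c₂) ≤ (1 - 17 * η) * (k * a₁ + k * a₂) :=
      mul_le_mul_of_nonneg_left hD (by linarith)
    nlinarith [mul_pos (mul_pos hka₁0 hη) hη, mul_pos (mul_pos hka₂0 hη) hη]
  · have h1 : A₁ * (m + c₂ * p) ≤ a₁ * k :=
      mul_le_mul hA₁' (upper hm' hp0 hp' hc₂1)
        (add_nonneg hm0.le (mul_nonneg (by linarith) hp0.le)) ha₁.le
    have h2 : A₂ * (p + c₁ * m) ≤ a₂ * k :=
      mul_le_mul hA₂' (upper hp' hm0 hm' hc₁1)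
        (add_nonneg hp0.le (mul_nonneg (by linarith) hm0.le)) ha₂.le
    have h3 : (1 + 20 * η) * ((k * a₁ + k * a₂) * (1 - 10 * η)) ≤
        (1 + 20 * η) * (1 - c₁ * c₂) := mul_le_mul_of_nonneg_left hD' (by linarith)
    have h4 : 1 ≤ (1 + 20 * η) * (1 - 10 * η) := by nlinarith
    nlinarith

lemma integral_exp_mul_wallMxw_bounds {κ r S T : ℝ} (hκ : 0 < κ) (hr : 0 ≤ r) (hr1 : r ≤ 1)
    (hS : 0 < S) (hST : S ≤ T) :
    √(π / (2 * T)) * (1 - 8 * (κ ^ 2 * S) ^ (-(1 : ℝ) / 4)) ≤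
        ∫ v in Ioi (0 : ℝ), Real.exp (-r / (κ * v)) * wallMxw T v ∧
      ∫ v in Ioi (0 : ℝ), Real.exp (-r / (κ * v)) * wallMxw T v ≤ √(π / (2 * T)) := by
  have hT : 0 < T := hS.trans_le hST
  rw [integral_exp_mul_wallMxw hT]
  have h1 := mul_le_mul_of_nonneg_left (le_integral_exp_mul_Mxw hκ hr hr1 hS hST)
    (Real.sqrt_nonneg (π / (2 * T)))
  have h2 := mul_le_mul_of_nonneg_left (integral_exp_mul_Mxw_le hκ hr hT)
    (Real.sqrt_nonneg (π / (2 * T)))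
  constructor <;> linarith

lemma density_bounds_of_le {κ T₁ T₂ B : ℝ} {ρ T : ℝ → ℝ} {f : ℝ → ℝ → ℝ} (hκ : 0 < κ)
    (hT₁ : 0 < T₁) (hT₂ : T₁ ≤ T₂) (hη : (κ ^ 2 * T₁) ^ (-(1 : ℝ) / 4) ≤ 1 / 32)
    (hρm : Measurable ρ) (hρ : ∀ y, 0 ≤ ρ y) (hB : ∀ y ∈ Icc (0 : ℝ) 1, ρ y ≤ B)
    (hρ1 : ∫ y in Icc (0 : ℝ) 1, ρ y = 1) (hTm : Measurable T)
    (hT : ∀ y ∈ Icc (0 : ℝ) 1, T₁ ≤ T y ∧ T y ≤ T₂) (hf : IsMildSteadyState κ T₁ T₂ ρ T f)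
    {x : ℝ} (hx : x ∈ Icc (0 : ℝ) 1) :
    1 - 17 * (κ ^ 2 * T₁) ^ (-(1 : ℝ) / 4) ≤ ρ x ∧
      ρ x ≤ 1 + 20 * (κ ^ 2 * T₁) ^ (-(1 : ℝ) / 4) +
        16 * (κ ^ 2 * T₁) ^ (-(1 : ℝ) / 4) * B := by
  obtain ⟨-, hi₁, hi₂, hdens, hmild⟩ := hf
  obtain ⟨hpos, hneg⟩ := hmild x hx
  have hT₂0 : 0 < T₂ := hT₁.trans_le hT₂
  have hB0 : 0 ≤ B := (hρ x).trans (hB x hx)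
  have hη0 : 0 < (κ ^ 2 * T₁) ^ (-(1 : ℝ) / 4) := by positivity
  have hm := weighted_average_bounds hρ hρ1 hi₁
    (fun y hy => le_integral_exp_mul_Mxw hκ hy.1 hy.2 hT₁ (hT y hy).1)
    (fun y hy => integral_exp_mul_Mxw_le hκ hy.1 (hT₁.trans_le (hT y hy).1))
  have hp := weighted_average_bounds hρ hρ1 hi₂
    (fun y hy => le_integral_exp_mul_Mxw hκ (sub_nonneg.2 hy.2) (by linarith [hy.1]) hT₁ (hT y hy).1)
    (fun y hy => integral_exp_mul_Mxw_le hκ (sub_nonneg.2 hy.2) (hT₁.trans_le (hT y hy).1))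
  have hk : 0 < κ⁻¹ := inv_pos.2 hκ
  have ha : ∀ T', T₁ ≤ T' → κ⁻¹ * √(π / (2 * T')) ≤ 2 * (κ ^ 2 * T₁) ^ (-(1 : ℝ) / 4) :=
    fun T' h => (inv_mul_sqrt_le hκ hT₁ h).trans (by nlinarith)
  have hA₁ := integral_exp_mul_wallMxw_bounds hκ hx.1 hx.2 hT₁ le_rfl
  have hA₂ := integral_exp_mul_wallMxw_bounds (r := 1 - x) hκ (sub_nonneg.2 hx.2)
    (by linarith [hx.1]) hT₁ hT₂
  have hwall := wall_contribution_bounds hη0 hη hk (Real.sqrt_pos.2 (by positivity))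
    (Real.sqrt_pos.2 (by positivity)) (ha T₁ le_rfl) (ha T₂ hT₂) (le_Cwall hκ hT₁)
    (le_Cwall hκ hT₂0) (Cwall_le hκ hT₁ le_rfl) (Cwall_le hκ hT₁ hT₂)
    (m := Cminus κ ρ T) (p := Cplus κ ρ T)
    (mul_le_mul_of_nonneg_left hm.1 hk.le) (mul_le_mul_of_nonneg_left hm.2 hk.le)
    (mul_le_mul_of_nonneg_left hp.1 hk.le) (mul_le_mul_of_nonneg_left hp.2 hk.le)
    hA₁.1 hA₁.2 hA₂.1 hA₂.2
  have hsub₁ : ∀ y ∈ Ioo 0 x, y ∈ Icc (0 : ℝ) 1 := fun y hy => ⟨hy.1.le, hy.2.le.trans hx.2⟩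
  have hsub₂ : ∀ y ∈ Ioo x 1, y ∈ Icc (0 : ℝ) 1 := fun y hy => ⟨hx.1.trans hy.1.le, hy.2.le⟩
  have hsqrt : ∀ t : ℝ, t ≤ 1 → 2 * √t ≤ 2 := fun t ht => by
    linarith [Real.sqrt_le_one.2 ht]
  have hright := half_density_bounds (g := f x) (d := x) (r := fun y => x - y) hκ hT₁ hT₁ hB0 hx.1
    hρm hρ hTm (by fun_prop) (fun y hy => hB y (hsub₁ y hy)) (fun y hy => (hT y (hsub₁ y hy)).1)
    (fun y hy => sub_pos.2 hy.2) (integrableOn_inv_sqrt_sub_left hx.1).1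
    ((integrableOn_inv_sqrt_sub_left hx.1).2.trans_le (hsqrt x hx.2))
    (hpos.mono fun v hv => by
      rw [hv, intervalIntegral.integral_of_le hx.1, integral_Ioc_eq_integral_Ioo])
  have hneg' : ∀ᵐ v ∂(volume.restrict (Ioi (0 : ℝ))),
      f x (-v) = Real.exp (-(1 - x) / (κ * v)) * wallMxw T₂ v *
          ((Cplus κ ρ T + Cwall κ T₁ * Cminus κ ρ T) / (1 - Cwall κ T₁ * Cwall κ T₂)) +
        ∫ y in Ioo x 1, (κ * v)⁻¹ * Real.exp (-(y - x) / (κ * v)) * ρ y * Mxw (T y) v := by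
    rw [ae_restrict_iff' measurableSet_Iio] at hneg
    rw [ae_restrict_iff' measurableSet_Ioi]
    have hq := (Measure.measurePreserving_neg (volume : Measure ℝ)).quasiMeasurePreserving.ae hneg
    filter_upwards [hq] with v hv hv0
    have hv0' : (0 : ℝ) < v := hv0
    have h := hv (by simpa using hv0')
    simp only [abs_neg, abs_of_pos hv0', wallMxw_neg, Mxw_neg] at h
    rw [h, intervalIntegral.integral_of_le hx.2, integral_Ioc_eq_integral_Ioo]
  have hleft := half_density_bounds (g := fun v => f x (-v)) (d := 1 - x) (r := fun y => y - x) hκ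
    hT₁ hT₂0 hB0 (sub_nonneg.2 hx.2) hρm hρ hTm (by fun_prop) (fun y hy => hB y (hsub₂ y hy))
    (fun y hy => (hT y (hsub₂ y hy)).1) (fun y hy => sub_pos.2 hy.1)
    (integrableOn_inv_sqrt_sub_right hx.2).1
    ((integrableOn_inv_sqrt_sub_right hx.2).2.trans_le (hsqrt _ (by linarith [hx.1]))) hneg'
  have hleft_int : IntegrableOn (f x) (Iic 0) := by
    have := hleft.1
    rw [← integrableOn_Ici_iff_integrableOn_Ioi] at this
    simpa using this.comp_neg
  have hsplit : ρ x = (∫ v in Ioi (0 : ℝ), f x (-v)) + ∫ v in Ioi (0 : ℝ), f x v := by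
    rw [hdens x hx, integral_comp_neg_Ioi, neg_zero,
      intervalIntegral.integral_Iic_add_Ioi hleft_int hright.1]
  rw [hsplit]
  constructor
  · linarith [hright.2.1, hleft.2.1, hwall.1]
  · linarith [hright.2.2, hleft.2.2, hwall.2]

/-- the density of the mild steady state is close to `1` for large `κ²T₁`. -/
theorem density_bounds :
    ∃ Θ γ₀ γ₁ : ℝ, 1 ≤ Θ ∧ 0 < γ₀ ∧ 0 < γ₁ ∧
      ∀ κ T₁ T₂ : ℝ, 0 < κ → 0 < T₁ → 0 < T₂ → Θ ≤ κ ^ 2 * T₁ → T₁ ≤ T₂ →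
        ∀ ρ T : ℝ → ℝ, Measurable ρ → (∀ y, 0 ≤ ρ y) →
          (∃ B : ℝ, ∀ y ∈ Icc (0 : ℝ) 1, ρ y ≤ B) →
          (∫ y in Icc (0 : ℝ) 1, ρ y) = 1 →
          Measurable T → (∀ y, 0 < T y) →
          (∀ y ∈ Icc (0 : ℝ) 1, T₁ ≤ T y ∧ T y ≤ T₂) →
          ∀ f : ℝ → ℝ → ℝ, (∀ x v, 0 ≤ f x v) →
            IsMildSteadyState κ T₁ T₂ ρ T f →
            ∀ x ∈ Icc (0 : ℝ) 1,
              1 - γ₀ * (κ ^ 2 * T₁) ^ (-(1 : ℝ) / 4) ≤ ρ x ∧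
              ρ x ≤ 1 + γ₁ * (κ ^ 2 * T₁) ^ (-(1 : ℝ) / 4) := by
  refine ⟨32 ^ 4, 17, 84, by norm_num, by norm_num, by norm_num, ?_⟩
  intro κ T₁ T₂ hκ hT₁ _ hΘ hT₂ ρ T hρm hρ ⟨B, hB⟩ hρ1 hTm _ hT f _ hf x hx
  have hη : (κ ^ 2 * T₁) ^ (-(1 : ℝ) / 4) ≤ 1 / 32 := by
    calc (κ ^ 2 * T₁) ^ (-(1 : ℝ) / 4) ≤ ((32 : ℝ) ^ 4) ^ (-(1 : ℝ) / 4) :=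
          Real.rpow_le_rpow_of_nonpos (by norm_num) hΘ (by norm_num)
      _ = 1 / 32 := by
          rw [← Real.rpow_natCast, ← Real.rpow_mul (by norm_num)]
          norm_num
  have hη0 : 0 < (κ ^ 2 * T₁) ^ (-(1 : ℝ) / 4) := by positivity
  have hbdd : BddAbove (ρ '' Icc 0 1) := ⟨B, by rintro _ ⟨y, hy, rfl⟩; exact hB y hy⟩
  have hkey : ∀ y ∈ Icc (0 : ℝ) 1, _ := fun y hy =>
    density_bounds_of_le hκ hT₁ hT₂ hη hρm hρ
      (fun z hz => le_csSup hbdd (mem_image_of_mem ρ hz)) hρ1 hTm hT hf hy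
  have hsup : sSup (ρ '' Icc 0 1) ≤ _ :=
    csSup_le ⟨ρ x, mem_image_of_mem ρ hx⟩ (by rintro _ ⟨y, hy, rfl⟩; exact (hkey y hy).2)
  have hsup0 : 0 ≤ sSup (ρ '' Icc 0 1) := (hρ x).trans (le_csSup hbdd (mem_image_of_mem ρ hx))
  refine ⟨(hkey x hx).1, (hkey x hx).2.trans ?_⟩
  have hsup4 : sSup (ρ '' Icc 0 1) ≤ 4 := by nlinarith
  nlinarith
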